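/- The leave-out estimator can be written as a quadratic form in outcomes with zero diagonal: θ̂ = Σ_{i=1}^n Σ_{ℓ≠i} C_{iℓ} y_i y_ℓ, where C_{iℓ} = B_{iℓ} − (1/2) M_{iℓ}(M_ii⁻¹ B_ii + M_{ℓℓ}⁻¹ B_{ℓℓ}), B_{iℓ} = x_i' S_xx⁻¹ A S_xx⁻¹ x_ℓ, and M_{iℓ} = 1{i=ℓ} − x_i' S_xx⁻¹ x_ℓ. -/

import Mathlib

open Matrix BigOperators Finset

/-- The leave-one-out residual is the full-sample residual divided by one minus the leverage. -/
theorem leave_one_out_residual {m : Type*} [Fintype m] [DecidableEq m]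
    (S : Matrix m m ℝ) (hS : IsUnit S.det) (u v : m → ℝ) (t : ℝ)
    (hu : u ⬝ᵥ S⁻¹.mulVec u ≠ 1) :
    t - u ⬝ᵥ (S - vecMulVec u u)⁻¹.mulVec (v - t • u)
      = (1 - u ⬝ᵥ S⁻¹.mulVec u)⁻¹ * (t - u ⬝ᵥ S⁻¹.mulVec v) := by
  have hd : 1 - u ⬝ᵥ S⁻¹.mulVec u ≠ 0 := sub_ne_zero.mpr hu.symm
  have hSinv : ∀ w, S.mulVec (S⁻¹.mulVec w) = w := fun w => by
    rw [mulVec_mulVec, mul_nonsing_inv _ hS, one_mulVec]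
  have hinvS : ∀ w, S⁻¹.mulVec (S.mulVec w) = w := fun w => by
    rw [mulVec_mulVec, nonsing_inv_mul _ hS, one_mulVec]
  have happ : ∀ w, (S - vecMulVec u u).mulVec w = S.mulVec w - (u ⬝ᵥ w) • u := fun w => by
    rw [sub_mulVec, vecMulVec_mulVec, op_smul_eq_smul]
  have hdet : IsUnit (S - vecMulVec u u).det := by
    rw [isUnit_iff_ne_zero]
    intro h0
    obtain ⟨w, hw, hw0⟩ := exists_mulVec_eq_zero_iff.mpr h0
    have hSw : S.mulVec w = (u ⬝ᵥ w) • u := by rwa [happ, sub_eq_zero] at hw0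
    have hw' : w = (u ⬝ᵥ w) • S⁻¹.mulVec u := by rw [← mulVec_smul, ← hSw, hinvS]
    have huw : u ⬝ᵥ w = (u ⬝ᵥ w) * (u ⬝ᵥ S⁻¹.mulVec u) := by
      conv_lhs => rw [hw', dotProduct_smul, smul_eq_mul]
    have hz : u ⬝ᵥ w = 0 := by
      have : (u ⬝ᵥ w) * (1 - u ⬝ᵥ S⁻¹.mulVec u) = 0 := by linarith
      exact (mul_eq_zero.mp this).resolve_right hd
    exact hw (by rw [hw', hz, zero_smul])
  set c := (1 - u ⬝ᵥ S⁻¹.mulVec u)⁻¹ * (t - u ⬝ᵥ S⁻¹.mulVec v) with hc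
  have hcm : c * (1 - u ⬝ᵥ S⁻¹.mulVec u) = t - u ⬝ᵥ S⁻¹.mulVec v := by
    rw [hc]; field_simp
  have hsol : (S - vecMulVec u u).mulVec (S⁻¹.mulVec v - c • S⁻¹.mulVec u) = v - t • u := by
    rw [happ, mulVec_sub, mulVec_smul, hSinv, hSinv, dotProduct_sub, dotProduct_smul, smul_eq_mul]
    ext j
    simp only [Pi.sub_apply, Pi.smul_apply, smul_eq_mul]
    linear_combination (-u j) * hcm
  rw [← hsol, mulVec_mulVec, nonsing_inv_mul _ hdet, one_mulVec, dotProduct_sub,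
    dotProduct_smul, smul_eq_mul]
  linear_combination -hcm

/-- A bilinear expression in the scaled rows of a symmetric matrix may be symmetrized. -/
theorem sum_sum_mul_symmetrize {ι : Type*} [Fintype ι] (M : ι → ι → ℝ)
    (hM : ∀ i j, M i j = M j i) (d y : ι → ℝ) :
    ∑ i, ∑ j, d i * M i j * y i * y j
      = ∑ i, ∑ j, 1 / 2 * M i j * (d i + d j) * y i * y j := by
  have hswap : ∑ i, ∑ j, d i * M i j * y i * y j = ∑ i, ∑ j, d j * M i j * y i * y j := by
    rw [Finset.sum_comm]
    refine Finset.sum_congr rfl fun i _ => Finset.sum_congr rfl fun j _ => ?_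
    rw [hM j i]; ring
  have hsplit : ∑ i, ∑ j, 1 / 2 * M i j * (d i + d j) * y i * y j
      = 1 / 2 * (∑ i, ∑ j, d i * M i j * y i * y j)
        + 1 / 2 * ∑ i, ∑ j, d j * M i j * y i * y j := by
    simp only [Finset.mul_sum, ← Finset.sum_add_distrib]
    refine Finset.sum_congr rfl fun i _ => Finset.sum_congr rfl fun j _ => ?_
    ring
  rw [hsplit, ← hswap]; ring

/-- the leave-out estimator is a quadratic form in outcomes with zero
diagonal: `θ̂ = Σ_i Σ_{ℓ≠i} C_{iℓ} y_i y_ℓ`, with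
`C_{iℓ} = B_{iℓ} − (1/2) M_{iℓ} (M_ii⁻¹ B_ii + M_ℓℓ⁻¹ B_ℓℓ)`. -/
theorem leave_out_estimator_quadratic_form {n k : ℕ}
    (x : Fin n → Fin k → ℝ) (y : Fin n → ℝ)
    (A Sxx : Matrix (Fin k) (Fin k) ℝ)
    (hA : A.IsSymm)
    (hSxx : Sxx = ∑ i, vecMulVec (x i) (x i))
    (hS : IsUnit Sxx.det)
    (hP : ∀ i, x i ⬝ᵥ Sxx⁻¹.mulVec (x i) < 1)
    (βhat : Fin k → ℝ)
    (hβ : βhat = Sxx⁻¹.mulVec (∑ j, y j • x j))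
    (βhati : Fin n → Fin k → ℝ)
    (hβi : ∀ i, βhati i = (Sxx - vecMulVec (x i) (x i))⁻¹.mulVec
      (∑ j ∈ Finset.univ.erase i, y j • x j))
    (σhatsq : Fin n → ℝ)
    (hσ : ∀ i, σhatsq i = y i * (y i - x i ⬝ᵥ βhati i))
    (B : Fin n → Fin n → ℝ)
    (hB : ∀ i ℓ, B i ℓ = x i ⬝ᵥ (Sxx⁻¹ * A * Sxx⁻¹).mulVec (x ℓ))
    (M : Fin n → Fin n → ℝ)
    (hM : ∀ i ℓ, M i ℓ = (if i = ℓ then (1 : ℝ) else 0) - x i ⬝ᵥ Sxx⁻¹.mulVec (x ℓ))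
    (C : Fin n → Fin n → ℝ)
    (hC : ∀ i ℓ, C i ℓ = B i ℓ
      - (1 / 2) * M i ℓ * ((M i i)⁻¹ * B i i + (M ℓ ℓ)⁻¹ * B ℓ ℓ)) :
    βhat ⬝ᵥ A.mulVec βhat - ∑ i, B i i * σhatsq i
      = ∑ i, ∑ ℓ ∈ Finset.univ.erase i, C i ℓ * y i * y ℓ := by
  have hSymm : Sxx⁻¹ᵀ = Sxx⁻¹ := by
    rw [transpose_nonsing_inv, hSxx, transpose_sum]
    simp only [transpose_vecMulVec]
  have hSdot : ∀ v w, v ⬝ᵥ Sxx⁻¹.mulVec w = Sxx⁻¹.mulVec v ⬝ᵥ w := fun v w => by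
    rw [dotProduct_mulVec, ← mulVec_transpose, hSymm]
  have hMsymm : ∀ i j, M i j = M j i := fun i j => by
    rw [hM, hM, hSdot, dotProduct_comm]
    simp only [eq_comm]
  have hMii : ∀ i, M i i = 1 - x i ⬝ᵥ Sxx⁻¹.mulVec (x i) := fun i => by
    rw [hM, if_pos rfl]
  have hMne : ∀ i, M i i ≠ 0 := fun i => by
    rw [hMii]; exact (sub_pos.mpr (hP i)).ne'
  have hfit : ∀ i, x i ⬝ᵥ βhat = ∑ j, (x i ⬝ᵥ Sxx⁻¹.mulVec (x j)) * y j := fun i => by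
    simp only [hβ, mulVec_sum, dotProduct_sum, mulVec_smul, dotProduct_smul, smul_eq_mul, mul_comm]
  have hres : ∀ i, y i - x i ⬝ᵥ βhat = ∑ j, M i j * y j := fun i => by
    simp [hfit, hM, sub_mul, Finset.sum_sub_distrib]
  have hloo : ∀ i, y i - x i ⬝ᵥ βhati i = (M i i)⁻¹ * ∑ j, M i j * y j := fun i => by
    have hsum : ∑ j ∈ Finset.univ.erase i, y j • x j = ∑ j, y j • x j - y i • x i :=
      Finset.sum_erase_eq_sub (Finset.mem_univ i)
    rw [hβi, hsum, leave_one_out_residual Sxx hS _ _ _ (hP i).ne, ← hβ, hres, hMii]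
  have hquad : βhat ⬝ᵥ A.mulVec βhat = ∑ i, ∑ j, B i j * y i * y j := by
    have hβA : βhat ⬝ᵥ A.mulVec βhat
        = (∑ i, y i • x i) ⬝ᵥ (Sxx⁻¹ * A * Sxx⁻¹).mulVec (∑ j, y j • x j) := by
      rw [← mulVec_mulVec, ← mulVec_mulVec, ← hβ, hSdot, ← hβ]
    rw [hβA]
    simp only [sum_dotProduct, mulVec_sum, dotProduct_sum, mulVec_smul, dotProduct_smul,
      smul_dotProduct, smul_eq_mul, hB, Finset.mul_sum]
    rw [Finset.sum_comm]
    refine Finset.sum_congr rfl fun i _ => Finset.sum_congr rfl fun j _ => ?_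
    ring
  have hvar : ∑ i, B i i * σhatsq i
      = ∑ i, ∑ j, (M i i)⁻¹ * B i i * M i j * y i * y j := by
    refine Finset.sum_congr rfl fun i _ => ?_
    rw [hσ, hloo]
    simp only [Finset.mul_sum]
    refine Finset.sum_congr rfl fun j _ => ?_
    ring
  have hCii : ∀ i, C i i = 0 := fun i => by
    have := hMne i
    rw [hC]; field_simp; ring
  rw [hquad, hvar, sum_sum_mul_symmetrize M hMsymm (fun i => (M i i)⁻¹ * B i i) y,
    ← Finset.sum_sub_distrib]
  refine Finset.sum_congr rfl fun i _ => ?_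
  rw [Finset.sum_erase _ (by rw [hCii]; ring), ← Finset.sum_sub_distrib]
  refine Finset.sum_congr rfl fun j _ => ?_
  rw [hC]; ring
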